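/- Suppose char K = 2 and φ ∈ O(V,Q) is orthogonally indecomposable. Then there exists σ ∈ O(V,Q) with σ² = 1, σφσ = φ⁻¹, and 2·dim ker(σ − 1) = dim V. -/

import Mathlib

open Polynomial Module

variable {K V : Type*}

section Defs

variable [Field K] [AddCommGroup V] [Module K V]

/-- The polar form `f_Q(u,w) = Q(u+w) - Q u - Q w` of a quadratic form. -/
def polarF (Q : QuadraticForm K V) (u w : V) : K := Q (u + w) - Q u - Q w

/-- `Q` is nondefective: its polar form is nondegenerate. -/
def Nondefective (Q : QuadraticForm K V) : Prop :=
  ∀ u : V, (∀ w : V, polarF Q u w = 0) → u = 0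

/-- Membership in the orthogonal group `O(V,Q)`. -/
def InO (Q : QuadraticForm K V) (φ : V ≃ₗ[K] V) : Prop := ∀ v : V, Q (φ v) = Q v

/-- Membership in the special orthogonal group `SO(V,Q)`:
orthogonal and `dim im(φ - 1)` is even. -/
def InSO (Q : QuadraticForm K V) (φ : V ≃ₗ[K] V) : Prop :=
  InO Q φ ∧ Even (Module.finrank K (LinearMap.range (φ.toLinearMap - LinearMap.id)))

/-- `φ` is a product of two involutions of `SO(V,Q)`. -/
def BireflSO (Q : QuadraticForm K V) (φ : V ≃ₗ[K] V) : Prop :=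
  ∃ σ τ : V ≃ₗ[K] V, InSO Q σ ∧ InSO Q τ ∧ σ * σ = 1 ∧ τ * τ = 1 ∧ φ = σ * τ

/-- A subspace is totally isotropic if `Q` vanishes on it. -/
def TotIsotropic (Q : QuadraticForm K V) (U : Submodule K V) : Prop := ∀ u ∈ U, Q u = 0

/-- A subspace invariant under a linear map. -/
def Invariant (f : V →ₗ[K] V) (U : Submodule K V) : Prop := ∀ u ∈ U, f u ∈ U

/-- The restriction of the polar form of `Q` to `U` is nondegenerate. -/
def NondegOn (Q : QuadraticForm K V) (U : Submodule K V) : Prop :=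
  ∀ u ∈ U, (∀ w ∈ U, polarF Q u w = 0) → u = 0

/-- `f` is orthogonally indecomposable: no invariant subspace `W` with
`0 < dim W < dim V` on which the polar form of `Q` is nondegenerate. -/
def OrthIndec (Q : QuadraticForm K V) (f : V →ₗ[K] V) : Prop :=
  ¬ ∃ W : Submodule K V, Invariant f W ∧ 0 < Module.finrank K W ∧
      Module.finrank K W < Module.finrank K V ∧ NondegOn Q W

/-- The subspace spanned by the `f`-orbit of `x`. -/
def cyclicSpan (f : V →ₗ[K] V) (x : V) : Submodule K V :=
  Submodule.span K (Set.range fun k : ℕ => (f ^ k) x)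

/-- `f` is a cyclic linear map. -/
def IsCyclicEnd (f : V →ₗ[K] V) : Prop := ∃ x : V, cyclicSpan f x = ⊤

/-- `f` is of type 1 with exponent `m`: orthogonally indecomposable, bicyclic, and
with minimal polynomial `(X - 1) ^ m`. -/
def IsType1 (Q : QuadraticForm K V) (f : V →ₗ[K] V) (m : ℕ) : Prop :=
  OrthIndec Q f ∧ 1 ≤ m ∧ minpoly K f = (X - 1) ^ m ∧
    ∃ x z : V, IsCompl (cyclicSpan f x) (cyclicSpan f z)

/-- Type 1o: type 1 with odd exponent. -/
def IsType1o (Q : QuadraticForm K V) (f : V →ₗ[K] V) : Prop :=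
  ∃ m : ℕ, IsType1 Q f m ∧ Odd m

/-- Type 1e: type 1 with even exponent. -/
def IsType1e (Q : QuadraticForm K V) (f : V →ₗ[K] V) : Prop :=
  ∃ m : ℕ, IsType1 Q f m ∧ Even m

/-- The quadratic space `(V,Q)` is hyperbolic. -/
def HyperbolicSpace (Q : QuadraticForm K V) : Prop :=
  ∃ U W : Submodule K V, TotIsotropic Q U ∧ TotIsotropic Q W ∧ IsCompl U W

/-- The transformation `f` is hyperbolic: `V` is a direct sum of two totally isotropic
`f`-invariant subspaces. -/
def HyperbolicMap (Q : QuadraticForm K V) (f : V →ₗ[K] V) : Prop :=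
  ∃ U W : Submodule K V, TotIsotropic Q U ∧ TotIsotropic Q W ∧
    Invariant f U ∧ Invariant f W ∧ IsCompl U W

/-- `f` is semisimple: every invariant subspace has an invariant complement. -/
def SemisimpleEnd (f : V →ₗ[K] V) : Prop :=
  ∀ U : Submodule K V, Invariant f U → ∃ W : Submodule K V, Invariant f W ∧ IsCompl U W

end Defs

section Reversing

open scoped LaurentPolynomial
open LaurentPolynomial (T invert)
open QuadraticMap (polar)

/-- The element `T + T⁻¹`, fixed by the inversion of the Laurent polynomials. -/
noncomputable abbrev traceElt (K : Type*) [Field K] : K[T;T⁻¹] := T 1 + T (-1)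

/-- The element `T + 1`, which is `T - 1` in characteristic two. -/
noncomputable abbrev augElt (K : Type*) [Field K] : K[T;T⁻¹] := T 1 + 1

section Ring

variable [Field K]

lemma T_mul_T_neg (n : ℤ) : (T n * T (-n) : K[T;T⁻¹]) = 1 := by
  rw [← LaurentPolynomial.T_add, add_neg_cancel, LaurentPolynomial.T_zero]

lemma laurent_two_eq_zero [CharP K 2] : (2 : K[T;T⁻¹]) = 0 := by
  rw [← map_ofNat (algebraMap K K[T;T⁻¹]) 2, CharTwo.two_eq_zero, map_zero]

lemma invert_aeval_traceElt (q : K[X]) :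
    invert (aeval (traceElt K) q) = aeval (traceElt K) q := by
  have h : invert (traceElt K) = traceElt K := by
    simp [traceElt, add_comm]
  conv_rhs => rw [← h]
  exact (aeval_algHom_apply (invert (R := K)).toAlgHom _ q).symm

lemma invert_augElt : invert (augElt K) = T (-1) * augElt K := by
  have := T_mul_T_neg (K := K) 1
  simp only [augElt, map_add, map_one, LaurentPolynomial.invert_T]
  linear_combination -this

lemma augElt_sq [CharP K 2] : augElt K ^ 2 = traceElt K * T 1 := by
  have := T_mul_T_neg (K := K) 1
  simp only [augElt, traceElt]
  linear_combination T 1 * laurent_two_eq_zero (K := K) - this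

lemma augElt_pow_two_mul [CharP K 2] (j : ℕ) :
    augElt K ^ (2 * j) = traceElt K ^ j * T j := by
  rw [pow_mul, augElt_sq, mul_pow, LaurentPolynomial.T_pow, mul_one]

/-- Every Laurent polynomial is a constant modulo `T + 1` in characteristic two. -/
lemma exists_eq_algebraMap_add_augElt_mul [CharP K 2] (r : K[T;T⁻¹]) :
    ∃ (c : K) (d : K[T;T⁻¹]), r = algebraMap K _ c + augElt K * d := by
  have h2 := laurent_two_eq_zero (K := K)
  induction r using LaurentPolynomial.induction_on with
  | h_C a => exact ⟨a, 0, by rw [LaurentPolynomial.C_eq_algebraMap, mul_zero, add_zero]⟩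
  | h_add hp hq =>
    obtain ⟨c, d, rfl⟩ := hp
    obtain ⟨c', d', rfl⟩ := hq
    exact ⟨c + c', d + d', by rw [map_add]; ring⟩
  | h_C_mul_T n a h =>
    obtain ⟨c, d, h⟩ := h
    refine ⟨c, T 1 * d + algebraMap K _ c, ?_⟩
    rw [LaurentPolynomial.T_add, ← mul_assoc, h, augElt]
    linear_combination -algebraMap K K[T;T⁻¹] c * h2
  | h_C_mul_T_Z n a h =>
    obtain ⟨c, d, h⟩ := h
    refine ⟨c, T (-1) * d - T (-1) * algebraMap K _ c, ?_⟩
    rw [LaurentPolynomial.T_sub, ← mul_assoc, h, augElt]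
    linear_combination algebraMap K K[T;T⁻¹] c * T (-1) * h2 + algebraMap K K[T;T⁻¹] c *
      T_mul_T_neg (K := K) 1

lemma augElt_dvd_T_sub_one [CharP K 2] (n : ℤ) : augElt K ∣ T n - 1 := by
  have h2 := laurent_two_eq_zero (K := K)
  induction n using Int.induction_on with
  | zero => simp
  | succ i h =>
    have : (T ((i : ℤ) + 1) - 1 : K[T;T⁻¹]) = T 1 * (T (i : ℤ) - 1) + augElt K := by
      rw [LaurentPolynomial.T_add, augElt]; linear_combination -h2
    rw [this]
    exact dvd_add (h.mul_left _) dvd_rfl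
  | pred i h =>
    have : (T (-(i : ℤ) - 1) - 1 : K[T;T⁻¹]) =
        T (-1) * (T (-(i : ℤ)) - 1) + T (-1) * augElt K := by
      rw [LaurentPolynomial.T_sub, augElt]
      linear_combination -T_mul_T_neg (K := K) 1 - h2
    rw [this]
    exact dvd_add (h.mul_left _) (dvd_mul_left _ _)

/-- `K[T;T⁻¹]` is generated by `1` and `T` over the subring `K[T + T⁻¹]`. -/
lemma exists_eq_aeval_traceElt_add (r : K[T;T⁻¹]) :
    ∃ a b : K[X], r = aeval (traceElt K) a + aeval (traceElt K) b * T 1 := by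
  induction r using LaurentPolynomial.induction_on with
  | h_C a => exact ⟨Polynomial.C a, 0, by
    rw [LaurentPolynomial.C_eq_algebraMap, aeval_C, map_zero, zero_mul, add_zero]⟩
  | h_add hp hq =>
    obtain ⟨c, d, rfl⟩ := hp
    obtain ⟨c', d', rfl⟩ := hq
    exact ⟨c + c', d + d', by simp only [map_add]; ring⟩
  | h_C_mul_T n a h =>
    obtain ⟨c, d, h⟩ := h
    refine ⟨-d, c + X * d, ?_⟩
    rw [LaurentPolynomial.T_add, ← mul_assoc, h]
    simp only [map_neg, map_add, map_mul, aeval_X, traceElt]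
    linear_combination -aeval (traceElt K) d * T_mul_T_neg (K := K) 1
  | h_C_mul_T_Z n a h =>
    obtain ⟨c, d, h⟩ := h
    refine ⟨d + X * c, -c, ?_⟩
    rw [LaurentPolynomial.T_sub, ← mul_assoc, h]
    simp only [map_neg, map_add, map_mul, aeval_X, traceElt]
    linear_combination aeval (traceElt K) d * T_mul_T_neg (K := K) 1

end Ring

section Form

variable [Field K] [AddCommGroup V] [Module K V] [Module K[T;T⁻¹] V]
  [IsScalarTower K K[T;T⁻¹] V] {Q : QuadraticForm K V}

lemma polar_laurent_smul (hT : ∀ v, Q ((T 1 : K[T;T⁻¹]) • v) = Q v) (r : K[T;T⁻¹]) (x y : V) :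
    polar Q (r • x) y = polar Q x (invert r • y) := by
  have h1 (x y : V) : polar Q ((T 1 : K[T;T⁻¹]) • x) ((T 1 : K[T;T⁻¹]) • y) = polar Q x y := by
    simp only [polar, ← smul_add, hT]
  have h2 (x y : V) : polar Q ((T 1 : K[T;T⁻¹]) • x) y = polar Q x ((T (-1) : K[T;T⁻¹]) • y) := by
    rw [← h1 x, smul_smul, T_mul_T_neg, one_smul]
  have h3 (x y : V) : polar Q ((T (-1) : K[T;T⁻¹]) • x) y = polar Q x ((T 1 : K[T;T⁻¹]) • y) := by
    rw [QuadraticMap.polar_comm, ← h2, QuadraticMap.polar_comm]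
  induction r using LaurentPolynomial.induction_on generalizing x y with
  | h_C a =>
    rw [LaurentPolynomial.C_eq_algebraMap, AlgEquiv.commutes, algebraMap_smul, algebraMap_smul,
      QuadraticMap.polar_smul_left, QuadraticMap.polar_smul_right]
  | h_add hp hq =>
    simp only [add_smul, QuadraticMap.polar_add_left, hp, hq, map_add,
      QuadraticMap.polar_add_right]
  | h_C_mul_T n a h =>
    rw [LaurentPolynomial.T_add, ← mul_assoc, mul_smul, h, h2, map_mul invert _ (T 1),
      mul_comm (invert _) (invert (T 1)), mul_smul, LaurentPolynomial.invert_T]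
  | h_C_mul_T_Z n a h =>
    rw [LaurentPolynomial.T_sub, ← mul_assoc, mul_smul, h, h3, map_mul invert _ (T (-1)),
      mul_comm (invert _) (invert (T (-1))), mul_smul, LaurentPolynomial.invert_T, neg_neg]

lemma polar_aeval_traceElt_smul (hT : ∀ v, Q ((T 1 : K[T;T⁻¹]) • v) = Q v) (q : K[X]) (x y : V) :
    polar Q (aeval (traceElt K) q • x) y = polar Q x (aeval (traceElt K) q • y) := by
  rw [polar_laurent_smul hT, invert_aeval_traceElt]

omit [Module K[T;T⁻¹] V] [IsScalarTower K K[T;T⁻¹] V] in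
lemma polar_self_eq_zero [CharP K 2] (x : V) : polar Q x x = 0 := by
  rw [QuadraticMap.polar_self, two_nsmul, CharTwo.add_self_eq_zero]

lemma polar_traceElt_smul_self [CharP K 2] (hT : ∀ v, Q ((T 1 : K[T;T⁻¹]) • v) = Q v) (x : V) :
    polar Q (traceElt K • x) x = 0 := by
  rw [traceElt, add_smul, QuadraticMap.polar_add_left, polar_laurent_smul hT (T (-1)),
    LaurentPolynomial.invert_T, neg_neg, QuadraticMap.polar_comm Q x, CharTwo.add_self_eq_zero]

lemma polar_aeval_traceElt_smul_self [CharP K 2] (hT : ∀ v, Q ((T 1 : K[T;T⁻¹]) • v) = Q v)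
    (q : K[X]) (x : V) : polar Q (aeval (traceElt K) q • x) x = 0 := by
  have key (j : ℕ) : polar Q (traceElt K ^ j • x) x = 0 := by
    have h (i : ℕ) (y z : V) : polar Q (traceElt K ^ i • y) z = polar Q y (traceElt K ^ i • z) := by
      simpa using polar_aeval_traceElt_smul hT (X ^ i) y z
    rcases Nat.even_or_odd' j with ⟨i, rfl | rfl⟩
    · rw [two_mul, pow_add, mul_smul, h, polar_self_eq_zero]
    · rw [two_mul, add_assoc, pow_add, mul_smul, h, pow_succ', mul_smul,
        polar_traceElt_smul_self hT]
  induction q using Polynomial.induction_on' with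
  | add p q hp hq => rw [map_add, add_smul, QuadraticMap.polar_add_left, hp, hq, add_zero]
  | monomial n a =>
    rw [aeval_monomial, mul_smul, algebraMap_smul, QuadraticMap.polar_smul_left, key, smul_zero]

omit [IsScalarTower K K[T;T⁻¹] V] in
lemma map_augElt_smul [CharP K 2] (hT : ∀ v, Q ((T 1 : K[T;T⁻¹]) • v) = Q v) (x : V) :
    Q (augElt K • x) = polar Q ((T 1 : K[T;T⁻¹]) • x) x := by
  rw [augElt, add_smul, one_smul, QuadraticMap.map_add Q, hT, CharTwo.add_self_eq_zero, zero_add]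

lemma polar_augElt_pow_smul [CharP K 2] (hT : ∀ v, Q ((T 1 : K[T;T⁻¹]) • v) = Q v) (j : ℕ)
    (x y : V) :
    polar Q (augElt K ^ j • x) (augElt K ^ j • y) = polar Q (traceElt K ^ j • x) y := by
  have h : traceElt K = augElt K * invert (augElt K) := by
    rw [invert_augElt, mul_left_comm, ← pow_two, augElt_sq, mul_left_comm, mul_comm (T (-1)),
      T_mul_T_neg, mul_one]
  rw [h, mul_pow, mul_comm, mul_smul, ← map_pow, polar_laurent_smul hT (invert _)]
  congr 2
  exact (LaurentPolynomial.involutive_invert _).symm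

lemma map_augElt_pow_succ_smul [CharP K 2] (hT : ∀ v, Q ((T 1 : K[T;T⁻¹]) • v) = Q v) (j : ℕ)
    (x : V) :
    Q (augElt K ^ (j + 1) • x) = polar Q ((traceElt K ^ j * T 1 : K[T;T⁻¹]) • x) x := by
  rw [pow_succ', mul_smul, map_augElt_smul hT, smul_comm, polar_augElt_pow_smul hT, mul_smul]

end Form

section Involution

variable [Field K] [AddCommGroup V] [Module K V]

/-- If `V = U ⊕ σ U` for an involution `σ`, its fixed space has half the dimension of `V`. -/
lemma two_mul_finrank_ker_sub_id [CharP K 2] [FiniteDimensional K V] (σ : V →ₗ[K] V)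
    (hσ : ∀ v, σ (σ v) = v) (U : Submodule K V) (hsup : ∀ v, ∃ a ∈ U, ∃ b ∈ U, v = a + σ b)
    (hinf : ∀ a ∈ U, ∀ b ∈ U, a = σ b → a = 0) :
    2 * Module.finrank K (LinearMap.ker (σ - LinearMap.id)) = Module.finrank K V := by
  have hV (v : V) : v + v = 0 := by
    rw [← two_smul K v, CharTwo.two_eq_zero, zero_smul]
  have hle : LinearMap.range (σ - LinearMap.id) ≤ LinearMap.ker (σ - LinearMap.id) := by
    rintro _ ⟨v, rfl⟩
    have h2 : v - σ v - (σ v - v) = 0 := by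
      rw [← neg_sub (σ v) v, ← neg_add', hV, neg_zero]
    simpa [hσ] using h2
  have hge : LinearMap.ker (σ - LinearMap.id) ≤ LinearMap.range (σ - LinearMap.id) := by
    intro v hv
    obtain ⟨a, ha, b, hb, rfl⟩ := hsup v
    have hv' : σ a + b = a + σ b := by
      simpa [hσ, sub_eq_zero] using hv
    have hab : a - b = 0 := by
      refine hinf _ (U.sub_mem ha hb) _ (U.sub_mem ha hb) ?_
      rw [map_sub, sub_eq_sub_iff_add_eq_add, ← hv']
    refine ⟨b, ?_⟩
    rw [sub_eq_zero.mp hab]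
    simp only [LinearMap.sub_apply, LinearMap.id_apply]
    rw [sub_eq_iff_eq_add, add_right_comm, hV, zero_add]
  have := LinearMap.finrank_range_add_finrank_ker (σ - LinearMap.id)
  rw [le_antisymm hle hge] at this
  omega

variable [Module K[T;T⁻¹] V] [IsScalarTower K K[T;T⁻¹] V] {Q : QuadraticForm K V}

/-- Two generating families of a nondefective space with matching Gram data are exchanged by an
isometry which is semilinear with respect to the inversion of `K[T;T⁻¹]`. -/
lemma exists_isometry_semilinear (hQ : Nondefective Q)
    (hT : ∀ v, Q ((T 1 : K[T;T⁻¹]) • v) = Q v) {κ : Type*} (x y : κ → V)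
    (hx : Submodule.span K[T;T⁻¹] (Set.range x) = ⊤)
    (hy : Submodule.span K[T;T⁻¹] (Set.range y) = ⊤) (hxy : ∀ a, Q (x a) = Q (y a))
    (hpol : ∀ a b (n : ℤ), polar Q ((T n : K[T;T⁻¹]) • x a) (x b) =
      polar Q (y a) ((T n : K[T;T⁻¹]) • y b)) :
    ∃ σ : V →ₗ[K] V, (∀ v, Q (σ v) = Q v) ∧
      (∀ (r : K[T;T⁻¹]) v, σ (r • v) = invert r • σ v) ∧ ∀ a, σ (x a) = y a := by
  have hQT (n : ℤ) (v : V) : Q ((T n : K[T;T⁻¹]) • v) = Q v := by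
    induction n using Int.induction_on generalizing v with
    | zero => rw [LaurentPolynomial.T_zero, one_smul]
    | succ i h => rw [LaurentPolynomial.T_add, mul_smul, h, hT]
    | pred i h =>
      rw [← hT, smul_smul, ← LaurentPolynomial.T_add, add_sub_cancel, h]
  have hpol' (a b) (r : K[T;T⁻¹]) : polar Q (r • x a) (x b) = polar Q (y a) (r • y b) := by
    induction r using LaurentPolynomial.induction_on' with
    | add p q hp hq =>
      rw [add_smul, add_smul, QuadraticMap.polar_add_left, QuadraticMap.polar_add_right, hp, hq]
    | C_mul_T n c =>
      rw [LaurentPolynomial.C_eq_algebraMap, mul_smul, mul_smul, algebraMap_smul, algebraMap_smul,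
        QuadraticMap.polar_smul_left, QuadraticMap.polar_smul_right, hpol]
  let F : (κ →₀ K[T;T⁻¹]) →ₗ[K] V := (Finsupp.linearCombination K[T;T⁻¹] x).restrictScalars K
  let G : (κ →₀ K[T;T⁻¹]) →ₗ[K] V := (Finsupp.linearCombination K[T;T⁻¹] y).restrictScalars K ∘ₗ
    Finsupp.mapRange.linearMap (invert (R := K)).toLinearMap
  have hF (a r) : F (Finsupp.single a r) = r • x a := by simp [F]
  have hG (a r) : G (Finsupp.single a r) = invert r • y a := by simp [G]
  have hFsurj (v : V) : ∃ c, F c = v := by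
    have : v ∈ Submodule.span K[T;T⁻¹] (Set.range x) := hx ▸ Submodule.mem_top
    exact Finsupp.mem_span_range_iff_exists_finsupp.mp this
  have hFsmul (r : K[T;T⁻¹]) (c) : F (r • c) = r • F c := by simp [F]
  have hGsmul (r : K[T;T⁻¹]) (c) : G (r • c) = invert r • G c := by
    induction c using Finsupp.induction_linear with
    | zero => simp
    | add f g hf hg => rw [smul_add, map_add, hf, hg, map_add, smul_add]
    | single a s => rw [Finsupp.smul_single, hG, hG, smul_eq_mul, map_mul, mul_smul]
  have hGsurj (v : V) : ∃ c, G c = v := by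
    have : v ∈ Submodule.span K[T;T⁻¹] (Set.range y) := hy ▸ Submodule.mem_top
    induction this using Submodule.span_induction with
    | mem v hv =>
      obtain ⟨a, rfl⟩ := hv
      exact ⟨Finsupp.single a 1, by rw [hG, map_one, one_smul]⟩
    | zero => exact ⟨0, map_zero G⟩
    | add v w _ _ hv hw =>
      obtain ⟨c, rfl⟩ := hv
      obtain ⟨d, rfl⟩ := hw
      exact ⟨c + d, map_add G c d⟩
    | smul r v _ hv =>
      obtain ⟨c, rfl⟩ := hv
      exact ⟨invert r • c, by rw [hGsmul, LaurentPolynomial.involutive_invert r]⟩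
  have hB (c d) : polar Q (F c) (F d) = polar Q (G c) (G d) := by
    induction c using Finsupp.induction_linear with
    | zero => simp
    | add f g hf hg =>
      rw [map_add, map_add, QuadraticMap.polar_add_left, QuadraticMap.polar_add_left, hf, hg]
    | single a r =>
      induction d using Finsupp.induction_linear with
      | zero => simp
      | add f g hf hg =>
        rw [map_add, map_add, QuadraticMap.polar_add_right, QuadraticMap.polar_add_right, hf, hg]
      | single b s =>
        rw [hF, hF, hG, hG, QuadraticMap.polar_comm, polar_laurent_smul hT,
          QuadraticMap.polar_comm, smul_smul, hpol', polar_laurent_smul hT (invert r), smul_smul,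
          LaurentPolynomial.involutive_invert r, mul_comm]
  have hFG (c) : Q (F c) = Q (G c) := by
    induction c using Finsupp.induction_linear with
    | zero => simp
    | add f g hf hg =>
      rw [map_add F, map_add G, QuadraticMap.map_add Q, QuadraticMap.map_add Q, hf, hg, hB]
    | single a r =>
      rw [hF, hG]
      induction r using LaurentPolynomial.induction_on' with
      | add p q hp hq =>
        rw [map_add, add_smul, add_smul, QuadraticMap.map_add Q, QuadraticMap.map_add Q, hp, hq,
          ← hF, ← hF, ← hG, ← hG, hB]
      | C_mul_T n c =>
        rw [LaurentPolynomial.C_eq_algebraMap, map_mul, AlgEquiv.commutes, mul_smul, mul_smul,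
          algebraMap_smul, algebraMap_smul, QuadraticMap.map_smul, QuadraticMap.map_smul,
          LaurentPolynomial.invert_T, hQT, hQT, hxy]
  have hker (c) (hc : F c = 0) : G c = 0 := by
    refine hQ _ fun w => ?_
    obtain ⟨d, rfl⟩ := hGsurj w
    exact (hB c d).symm.trans (by rw [hc, QuadraticMap.polar_zero_left])
  obtain ⟨S, hS⟩ := F.exists_rightInverse_of_surjective (LinearMap.range_eq_top.mpr hFsurj)
  have hσ (c) : G (S (F c)) = G c := by
    rw [← sub_eq_zero, ← map_sub]
    refine hker _ ?_
    rw [map_sub, ← LinearMap.comp_apply, hS, LinearMap.id_apply, sub_self]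
  refine ⟨G ∘ₗ S, fun v => ?_, fun r v => ?_, fun a => ?_⟩
  · obtain ⟨c, rfl⟩ := hFsurj v
    rw [LinearMap.comp_apply, hσ, hFG]
  · obtain ⟨c, rfl⟩ := hFsurj v
    rw [← hFsmul, LinearMap.comp_apply G S, LinearMap.comp_apply G S, hσ, hσ, hGsmul]
  · have : x a = F (Finsupp.single a 1) := by rw [hF, one_smul]
    rw [this, LinearMap.comp_apply, hσ, hG, map_one, one_smul]

omit [IsScalarTower K K[T;T⁻¹] V] in
/-- A semilinear map (for the inversion) which is involutive on generators is an involution. -/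
lemma involutive_of_semilinear {σ : V →ₗ[K] V}
    (hσ : ∀ (r : K[T;T⁻¹]) v, σ (r • v) = invert r • σ v) {s : Set V}
    (hs : Submodule.span K[T;T⁻¹] s = ⊤) (h : ∀ v ∈ s, σ (σ v) = v) (v : V) : σ (σ v) = v := by
  have : v ∈ Submodule.span K[T;T⁻¹] s := hs ▸ Submodule.mem_top
  induction this using Submodule.span_induction with
  | mem v hv => exact h v hv
  | zero => simp
  | add v w _ _ hv hw => rw [map_add, map_add, hv, hw]
  | smul r v _ hv => rw [hσ, hσ, hv, LaurentPolynomial.involutive_invert r]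

/-- Every nondegenerate `K[T;T⁻¹]`-submodule is `⊥` or `⊤`. -/
def NoNondegSubmodule (Q : QuadraticForm K V) : Prop :=
  ∀ W : Submodule K[T;T⁻¹] V, (∀ u ∈ W, (∀ w ∈ W, polar Q u w = 0) → u = 0) → W = ⊥ ∨ W = ⊤

/-- There is an isometric involution inverting `T` with fixed space of half the dimension. -/
def HasHalfInvolution (Q : QuadraticForm K V) : Prop :=
  ∃ σ : V →ₗ[K] V, (∀ v, Q (σ v) = Q v) ∧ (∀ v, σ (σ v) = v) ∧
    (∀ (r : K[T;T⁻¹]) v, σ (r • v) = invert r • σ v) ∧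
    2 * Module.finrank K (LinearMap.ker (σ - LinearMap.id)) = Module.finrank K V

/-- In an indecomposable space, a self-adjoint element acts nilpotently or injectively. -/
lemma pow_mem_annihilator_or_injective [FiniteDimensional K V] (hQ : Nondefective Q)
    (hT : ∀ v, Q ((T 1 : K[T;T⁻¹]) • v) = Q v) (hind : NoNondegSubmodule Q) (c : K[T;T⁻¹])
    (hc : invert c = c) :
    (∃ n, c ^ n ∈ Module.annihilator K[T;T⁻¹] V) ∨ ∀ v : V, c • v = 0 → v = 0 := by
  have : IsNoetherian K[T;T⁻¹] V := isNoetherian_of_tower K inferInstance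
  have : IsArtinian K[T;T⁻¹] V := isArtinian_of_tower K inferInstance
  obtain ⟨n, hn, hn1⟩ := ((LinearMap.eventually_isCompl_ker_pow_range_pow
    (LinearMap.lsmul K[T;T⁻¹] V c)).and (Filter.eventually_ge_atTop 1)).exists
  have hpow (v : V) : (LinearMap.lsmul K[T;T⁻¹] V c ^ n) v = c ^ n • v := by
    clear hn hn1
    induction n generalizing v with
    | zero => simp
    | succ m ih => rw [pow_succ, Module.End.mul_apply, ih, pow_succ, mul_smul]; rfl
  have hW := hind (LinearMap.ker (LinearMap.lsmul K[T;T⁻¹] V c ^ n)) fun u hu huW => by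
    refine hQ u fun w => ?_
    have hw : w ∈ LinearMap.ker (LinearMap.lsmul K[T;T⁻¹] V c ^ n) ⊔
      LinearMap.range (LinearMap.lsmul K[T;T⁻¹] V c ^ n) := hn.sup_eq_top ▸ Submodule.mem_top
    obtain ⟨a, ha, b, ⟨b, rfl⟩, rfl⟩ := Submodule.mem_sup.mp hw
    change polar Q _ _ = 0
    rw [LinearMap.mem_ker, hpow] at hu
    rw [QuadraticMap.polar_add_right, huW a ha, hpow, zero_add]
    have : invert (c ^ n) = c ^ n := by rw [map_pow, hc]
    rw [← this, ← polar_laurent_smul hT, hu, QuadraticMap.polar_zero_left]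
  rcases hW with h | h
  · right
    intro v hv
    have : v ∈ LinearMap.ker (LinearMap.lsmul K[T;T⁻¹] V c ^ n) := by
      obtain ⟨m, rfl⟩ := Nat.exists_eq_add_of_le' hn1
      rw [LinearMap.mem_ker, hpow, pow_succ, mul_smul, hv, smul_zero]
    simpa [h] using this
  · left
    refine ⟨n, Module.mem_annihilator.mpr fun v => ?_⟩
    have : v ∈ LinearMap.ker (LinearMap.lsmul K[T;T⁻¹] V c ^ n) := h ▸ Submodule.mem_top
    rwa [LinearMap.mem_ker, hpow] at this

end Involution

section Cyclic

variable [Field K] [AddCommGroup V] [Module K V] [Module K[T;T⁻¹] V] [IsScalarTower K K[T;T⁻¹] V]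
  {Q : QuadraticForm K V}

/-- Let `p (T + T⁻¹) ^ (l + 1)` annihilate `V`. If `p (T + T⁻¹) ^ l` does not annihilate the form on
the orbit of `x`, elements of the radical of this orbit have coefficients divisible by
`p ^ (l + 1)`. -/
lemma pow_dvd_of_orthogonal_orbit [CharP K 2] (hT : ∀ v, Q ((T 1 : K[T;T⁻¹]) • v) = Q v)
    {p : K[X]} (hp : Irreducible p) {l : ℕ}
    (hl : aeval (traceElt K) p ^ (l + 1) ∈ Module.annihilator K[T;T⁻¹] V) {x : V} {q : K[X]}
    (hx : polar Q ((aeval (traceElt K) p ^ l * aeval (traceElt K) q * T 1) • x) x ≠ 0)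
    {a b : K[X]}
    (hab : ∀ r : K[T;T⁻¹],
      polar Q ((aeval (traceElt K) a + aeval (traceElt K) b * T 1) • x) (r • x) = 0) :
    p ^ (l + 1) ∣ a ∧ p ^ (l + 1) ∣ b := by
  have hl' (r : K[T;T⁻¹]) (v : V) : (aeval (traceElt K) p ^ (l + 1) * r) • v = 0 :=
    Module.mem_annihilator.mp (Ideal.mul_mem_right r _ hl) v
  have hdvd {c : K[X]} (hc : ∀ q : K[X], polar Q ((aeval (traceElt K) p ^ l *
      aeval (traceElt K) c * aeval (traceElt K) q * T 1) • x) x = 0) : p ∣ c := by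
    by_contra hpc
    obtain ⟨α, β, hαβ⟩ := (hp.coprime_iff_not_dvd.mpr hpc)
    apply hx
    have h1 := congrArg (aeval (traceElt K)) hαβ
    simp only [map_add, map_mul, map_one] at h1
    have h2 : aeval (traceElt K) p ^ l * aeval (traceElt K) q * T 1 =
        aeval (traceElt K) p ^ (l + 1) * (aeval (traceElt K) (α * q) * T 1) +
        aeval (traceElt K) p ^ l * aeval (traceElt K) c * aeval (traceElt K) (β * q) * T 1 := by
      simp only [map_mul]
      linear_combination -(aeval (traceElt K) p ^ l * aeval (traceElt K) q * T 1) * h1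
    rw [h2, add_smul, hl', zero_add, hc]
  suffices h : ∀ e ≤ l + 1, p ^ e ∣ a ∧ p ^ e ∣ b from h _ le_rfl
  intro e
  induction e with
  | zero => simp
  | succ e ih =>
    intro he
    obtain ⟨⟨a', rfl⟩, b', rfl⟩ := ih (by omega)
    obtain ⟨d, hd⟩ := Nat.exists_eq_add_of_le (Nat.le_of_succ_le_succ he)
    have hs (r : K[T;T⁻¹]) : polar Q ((aeval (traceElt K) p ^ l * (aeval (traceElt K) a' +
        aeval (traceElt K) b' * T 1)) • x) (r • x) = 0 := by
      have h1 : aeval (traceElt K) p ^ l * (aeval (traceElt K) a' + aeval (traceElt K) b' * T 1) =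
          aeval (traceElt K) (p ^ d) * (aeval (traceElt K) (p ^ e * a') +
          aeval (traceElt K) (p ^ e * b') * T 1) := by
        simp only [map_mul, map_pow, hd]; ring
      rw [h1, mul_smul, polar_aeval_traceElt_smul hT, smul_smul, hab]
    have hb : p ∣ b' := hdvd fun q => by
      have h1 := hs (aeval (traceElt K) q)
      rw [← polar_aeval_traceElt_smul hT, smul_smul] at h1
      have h2 : aeval (traceElt K) q * (aeval (traceElt K) p ^ l * (aeval (traceElt K) a' +
          aeval (traceElt K) b' * T 1)) = aeval (traceElt K) (q * p ^ l * a') +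
          aeval (traceElt K) p ^ l * aeval (traceElt K) b' * aeval (traceElt K) q * T 1 := by
        simp only [map_mul, map_pow]; ring
      rwa [h2, add_smul, QuadraticMap.polar_add_left, polar_aeval_traceElt_smul_self hT,
        zero_add] at h1
    have ha : p ∣ a' := hdvd fun q => by
      have h1 := hs (aeval (traceElt K) q * T (-1))
      have h3 : invert (aeval (traceElt K) q * T 1) = aeval (traceElt K) q * T (-1) := by
        rw [map_mul, invert_aeval_traceElt, LaurentPolynomial.invert_T]
      rw [← h3, ← polar_laurent_smul hT, smul_smul] at h1
      obtain ⟨b'', rfl⟩ := hb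
      have h2 : aeval (traceElt K) q * T 1 * (aeval (traceElt K) p ^ l * (aeval (traceElt K) a' +
          aeval (traceElt K) (p * b'') * T 1)) =
          aeval (traceElt K) p ^ l * aeval (traceElt K) a' * aeval (traceElt K) q * T 1 +
          aeval (traceElt K) p ^ (l + 1) *
            (aeval (traceElt K) q * T 1 * aeval (traceElt K) b'' * T 1) := by
        simp only [map_mul]; ring
      rwa [h2, add_smul, hl', add_zero] at h1
    rw [pow_succ]
    exact ⟨mul_dvd_mul_left _ ha, mul_dvd_mul_left _ hb⟩

/-- The cyclic case. -/
lemma hasHalfInvolution_of_polar_ne_zero [CharP K 2] [FiniteDimensional K V] (hQ : Nondefective Q)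
    (hT : ∀ v, Q ((T 1 : K[T;T⁻¹]) • v) = Q v) (hind : NoNondegSubmodule Q)
    {p : K[X]} (hp : Irreducible p) {l : ℕ}
    (hl : aeval (traceElt K) p ^ (l + 1) ∈ Module.annihilator K[T;T⁻¹] V) {x : V} {q : K[X]}
    (hx : polar Q ((aeval (traceElt K) p ^ l * aeval (traceElt K) q * T 1) • x) x ≠ 0) :
    HasHalfInvolution Q := by
  have hzero {a : K[X]} (ha : p ^ (l + 1) ∣ a) (v : V) : aeval (traceElt K) a • v = 0 := by
    obtain ⟨c, rfl⟩ := ha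
    rw [map_mul, map_pow]
    exact Module.mem_annihilator.mp (Ideal.mul_mem_right _ _ hl) v
  have htop : Submodule.span K[T;T⁻¹] {x} = ⊤ := by
    refine (hind _ fun u hu huW => ?_).resolve_left fun h => ?_
    · obtain ⟨r, rfl⟩ := Submodule.mem_span_singleton.mp hu
      obtain ⟨a, b, rfl⟩ := exists_eq_aeval_traceElt_add r
      obtain ⟨ha, hb⟩ := pow_dvd_of_orthogonal_orbit hT hp hl hx
        fun r => huW _ (Submodule.mem_span_singleton.mpr ⟨r, rfl⟩)
      rw [add_smul, hzero ha, mul_smul, hzero hb, add_zero]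
    · rw [Submodule.span_singleton_eq_bot] at h
      simp [h] at hx
  have htop' : Submodule.span K[T;T⁻¹] {(T 1 : K[T;T⁻¹]) • x} = ⊤ := by
    rw [Submodule.span_singleton_smul_eq (LaurentPolynomial.isUnit_T 1), htop]
  obtain ⟨σ, hσQ, hσ, hσx⟩ := exists_isometry_semilinear hQ hT (fun _ : Unit => x)
    (fun _ : Unit => (T 1 : K[T;T⁻¹]) • x) (by simpa using htop) (by simpa using htop')
    (fun _ => (hT x).symm) fun _ _ n => by
      rw [QuadraticMap.polar_comm Q ((T 1 : K[T;T⁻¹]) • x), smul_comm (T n) (T 1 : K[T;T⁻¹]) x,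
        polar_laurent_smul hT (T 1), LaurentPolynomial.invert_T, smul_smul, mul_comm (T (-1)),
        T_mul_T_neg, one_smul]
  have hinv := involutive_of_semilinear hσ htop (by
    rintro v rfl
    rw [hσx (), hσ, hσx (), smul_smul, LaurentPolynomial.invert_T, mul_comm, T_mul_T_neg,
      one_smul])
  have hσa (a : K[X]) : σ (aeval (traceElt K) a • x) = (aeval (traceElt K) a * T 1) • x := by
    rw [hσ, invert_aeval_traceElt, hσx (), mul_smul]
  refine ⟨σ, hσQ, hinv, hσ, two_mul_finrank_ker_sub_id σ hinv (LinearMap.range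
    ((LinearMap.toSpanSingleton K[T;T⁻¹] V x).restrictScalars K ∘ₗ
      (aeval (traceElt K)).toLinearMap)) (fun v => ?_) ?_⟩
  · have hv : v ∈ Submodule.span K[T;T⁻¹] {x} := htop ▸ Submodule.mem_top
    obtain ⟨r, rfl⟩ := Submodule.mem_span_singleton.mp hv
    obtain ⟨a, b, rfl⟩ := exists_eq_aeval_traceElt_add r
    refine ⟨_, ⟨a, rfl⟩, _, ⟨b, rfl⟩, ?_⟩
    simp [hσa, add_smul]
  · rintro _ ⟨a, rfl⟩ _ ⟨b, rfl⟩ hab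
    replace hab : aeval (traceElt K) a • x = σ (aeval (traceElt K) b • x) := hab
    change aeval (traceElt K) a • x = 0
    refine hzero (pow_dvd_of_orthogonal_orbit hT hp hl hx (a := a) (b := -b) fun r => ?_).1 x
    rw [hσa] at hab
    rw [add_smul, hab, ← add_smul, map_neg, neg_mul, add_neg_cancel, zero_smul,
      QuadraticMap.polar_zero_left]

end Cyclic

section Bicyclic

variable [Field K] [AddCommGroup V] [Module K V] [Module K[T;T⁻¹] V]

omit [Module K V] in
lemma T_smul_of_augElt_mul_mem [CharP K 2] {a : K[T;T⁻¹]}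
    (ha : augElt K * a ∈ Module.annihilator K[T;T⁻¹] V) (n : ℤ) (v : V) :
    (T n * a) • v = a • v := by
  obtain ⟨d, hd⟩ := augElt_dvd_T_sub_one (K := K) n
  have h : T n * a = d * (augElt K * a) + a := by linear_combination a * hd
  rw [h, add_smul, Module.mem_annihilator.mp (Ideal.mul_mem_left _ d ha), zero_add]

variable [IsScalarTower K K[T;T⁻¹] V] {Q : QuadraticForm K V}

/-- A functional with prescribed values on a nilpotent orbit, up to twists by powers of `T`. -/
lemma exists_dual_twisted_orbit [CharP K 2] {e : ℕ}
    (he : augElt K ^ (e + 1) ∈ Module.annihilator K[T;T⁻¹] V) {v : V}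
    (hv : augElt K ^ e • v ≠ 0) (c : ℕ → K) (d : ℕ → ℤ) :
    ∃ μ : Module.Dual K V, ∀ i ≤ e, μ ((T (d i) * augElt K ^ i : K[T;T⁻¹]) • v) = c i := by
  have hz (r : K[T;T⁻¹]) (m : ℕ) (hm : e < m) : (r * augElt K ^ m) • v = 0 := by
    obtain ⟨m', rfl⟩ := Nat.exists_eq_add_of_lt hm
    refine Module.mem_annihilator.mp (Ideal.mul_mem_left _ r ?_) v
    rw [add_right_comm, pow_add]
    exact Ideal.mul_mem_right _ _ he
  have hli : LinearIndependent K fun i : Fin (e + 1) =>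
      (T (d i) * augElt K ^ (i : ℕ) : K[T;T⁻¹]) • v := by
    rw [Fintype.linearIndependent_iff]
    intro g hg
    suffices h : ∀ n (hn : n < e + 1), g ⟨n, hn⟩ = 0 from fun i => h i i.2
    intro n
    induction n using Nat.strong_induction_on with
    | _ n ih =>
      intro hn
      have h1 := congrArg (augElt K ^ (e - n) • ·) hg
      simp only [Finset.smul_sum, smul_zero] at h1
      have h2 (j : ℕ) : augElt K ^ (e - n) * (T (d j) * augElt K ^ j) =
          T (d j) * augElt K ^ (e - n + j) := by
        rw [pow_add, mul_left_comm]
      rw [Finset.sum_eq_single ⟨n, hn⟩, smul_comm, smul_smul, h2,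
        Nat.sub_add_cancel (Nat.le_of_lt_succ hn),
        T_smul_of_augElt_mul_mem (by rwa [← pow_succ'])] at h1
      · exact (smul_eq_zero.mp h1).resolve_right hv
      · rintro ⟨j, hj⟩ - hjn
        rcases lt_or_gt_of_ne (fun h => hjn (Fin.ext h) : j ≠ n) with h | h
        · rw [ih j h hj, zero_smul, smul_zero]
        · rw [smul_comm, smul_smul, h2, hz _ _ (show e < e - n + j by have : n < j := h; omega),
            smul_zero]
      · exact fun h => absurd (Finset.mem_univ _) h
  obtain ⟨μ, hμ⟩ := LinearMap.exists_extend
    ((Basis.span hli).constr K fun i : Fin (e + 1) => c i)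
  refine ⟨μ, fun i hi => ?_⟩
  have h1 := LinearMap.congr_fun hμ (Basis.span hli ⟨i, Nat.lt_succ_of_le hi⟩)
  rw [Basis.constr_basis, LinearMap.comp_apply, Submodule.subtype_apply, Basis.span_apply] at h1
  exact h1

/-- Two vectors whose top layers pair nontrivially generate a submodule which is free over
`K[T;T⁻¹] ⧸ (T + 1) ^ (e + 1)` and has trivial radical. -/
lemma augElt_pow_dvd_of_orthogonal [CharP K 2]
    (hT : ∀ v, Q ((T 1 : K[T;T⁻¹]) • v) = Q v) {e : ℕ}
    (he : augElt K ^ (e + 1) ∈ Module.annihilator K[T;T⁻¹] V)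
    (halt : ∀ x, polar Q (augElt K ^ e • x) x = 0) {x v : V}
    (hvx : polar Q (augElt K ^ e • v) x ≠ 0) {r s : K[T;T⁻¹]}
    (hr : ∀ t : K[T;T⁻¹], polar Q (r • x + s • v) (t • x) = 0)
    (hs : ∀ t : K[T;T⁻¹], polar Q (r • x + s • v) (t • v) = 0) :
    augElt K ^ (e + 1) ∣ r ∧ augElt K ^ (e + 1) ∣ s := by
  have hxv : polar Q (augElt K ^ e • x) v ≠ 0 := by
    have h := halt (x + v)
    rw [smul_add, QuadraticMap.polar_add_left, QuadraticMap.polar_add_right,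
      QuadraticMap.polar_add_right, halt, halt, zero_add, add_zero, add_comm] at h
    rw [eq_neg_of_add_eq_zero_right h]
    exact neg_ne_zero.mpr hvx
  suffices h : ∀ m ≤ e + 1, augElt K ^ m ∣ r ∧ augElt K ^ m ∣ s from h _ le_rfl
  intro m
  induction m with
  | zero => simp
  | succ m ih =>
    intro hm
    obtain ⟨⟨r', hr'⟩, s', hs'⟩ := ih (by omega)
    obtain ⟨d, hd⟩ := Nat.exists_eq_add_of_le (Nat.le_of_succ_le_succ hm)
    obtain ⟨a, r'', rfl⟩ := exists_eq_algebraMap_add_augElt_mul r'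
    obtain ⟨b, s'', rfl⟩ := exists_eq_algebraMap_add_augElt_mul s'
    have hmul (c : K) (t : K[T;T⁻¹]) (w : V) :
        (augElt K ^ d * (augElt K ^ m * (algebraMap K _ c + augElt K * t))) • w =
          c • augElt K ^ e • w := by
      have h1 : augElt K ^ d * (augElt K ^ m * (algebraMap K _ c + augElt K * t)) =
          algebraMap K _ c * augElt K ^ e + augElt K ^ (e + 1) * t := by
        rw [hd]; ring
      rw [h1, add_smul, Module.mem_annihilator.mp (Ideal.mul_mem_right _ _ he), add_zero,
        mul_smul, algebraMap_smul]
    have hy : augElt K ^ d • (r • x + s • v) =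
        a • augElt K ^ e • x + b • augElt K ^ e • v := by
      rw [hr', hs', smul_add, smul_smul, smul_smul, hmul, hmul]
    have hx0 := hr (invert (augElt K ^ d))
    have hv0 := hs (invert (augElt K ^ d))
    rw [← polar_laurent_smul hT, hy, QuadraticMap.polar_add_left, QuadraticMap.polar_smul_left,
      QuadraticMap.polar_smul_left, halt, smul_zero] at hx0 hv0
    rw [zero_add] at hx0
    rw [add_zero] at hv0
    have hb : b = 0 := (smul_eq_zero.mp hx0).resolve_right hvx
    have ha : a = 0 := (smul_eq_zero.mp hv0).resolve_right hxv
    rw [hr', hs', ha, hb, map_zero, zero_add, zero_add, ← mul_assoc, ← mul_assoc, ← pow_succ]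
    exact ⟨dvd_mul_right _ _, dvd_mul_right _ _⟩

lemma polar_T_smul_self_of_dual [CharP K 2] (hT : ∀ v, Q ((T 1 : K[T;T⁻¹]) • v) = Q v) {x v : V}
    (hμ : ∀ j : ℕ, polar Q (traceElt K ^ j • v) x = Q (augElt K ^ j • v)) (n : ℤ) :
    polar Q ((T n + T (-n) : K[T;T⁻¹]) • v) x = polar Q ((T n : K[T;T⁻¹]) • v) v := by
  have hN (j : ℕ) : polar Q (traceElt K ^ j • v) v = 0 := by
    simpa using polar_aeval_traceElt_smul_self hT (X ^ j) v
  have key (m j : ℕ) : polar Q ((traceElt K ^ j * (T m + T (-m)) : K[T;T⁻¹]) • v) x =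
      polar Q ((traceElt K ^ j * T m : K[T;T⁻¹]) • v) v := by
    induction m using Nat.twoStepInduction generalizing j with
    | zero =>
      rw [Nat.cast_zero, neg_zero, LaurentPolynomial.T_zero, one_add_one_eq_two,
        laurent_two_eq_zero, mul_zero, zero_smul, QuadraticMap.polar_zero_left, mul_one, hN]
    | one =>
      rw [Nat.cast_one, ← map_augElt_pow_succ_smul hT, ← hμ, pow_succ]
    | more m ih1 ih2 =>
      have hT2 : (T ((m + 2 : ℕ) : ℤ) : K[T;T⁻¹]) = T 1 * T ((m + 1 : ℕ) : ℤ) := by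
        rw [← LaurentPolynomial.T_add]; push_cast; ring_nf
      have hT0 : (T (m : ℤ) : K[T;T⁻¹]) = T (-1) * T ((m + 1 : ℕ) : ℤ) := by
        rw [← LaurentPolynomial.T_add]; push_cast; ring_nf
      have hT2' : (T (-((m + 2 : ℕ) : ℤ)) : K[T;T⁻¹]) = T (-1) * T (-((m + 1 : ℕ) : ℤ)) := by
        rw [← LaurentPolynomial.T_add]; push_cast; ring_nf
      have hT0' : (T (-(m : ℤ)) : K[T;T⁻¹]) = T 1 * T (-((m + 1 : ℕ) : ℤ)) := by
        rw [← LaurentPolynomial.T_add]; push_cast; ring_nf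
      have h1 : (traceElt K ^ j * (T ((m + 2 : ℕ) : ℤ) + T (-((m + 2 : ℕ) : ℤ))) : K[T;T⁻¹]) =
          traceElt K ^ (j + 1) * (T ((m + 1 : ℕ) : ℤ) + T (-((m + 1 : ℕ) : ℤ))) -
          traceElt K ^ j * (T (m : ℤ) + T (-(m : ℤ))) := by
        rw [hT2, hT0, hT2', hT0', traceElt]; ring
      have h2 : (traceElt K ^ j * T ((m + 2 : ℕ) : ℤ) : K[T;T⁻¹]) =
          traceElt K ^ (j + 1) * T ((m + 1 : ℕ) : ℤ) - traceElt K ^ j * T (m : ℤ) := by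
        rw [hT2, hT0, traceElt]; ring
      rw [h1, h2, sub_smul, sub_smul, QuadraticMap.polar_sub_left, QuadraticMap.polar_sub_left,
        ih1, ih2]
  have key' (m : ℕ) := key m 0
  simp only [pow_zero, one_mul] at key'
  rcases Int.eq_nat_or_neg n with ⟨m, rfl | rfl⟩
  · exact key' m
  · rw [neg_neg, add_comm, key', polar_laurent_smul hT, LaurentPolynomial.invert_T,
      QuadraticMap.polar_comm]

/-- If the functional `polar Q · x` sends `(T + T⁻¹) ^ j • v` to `Q ((T + 1) ^ j • v)`, the pairs
`(x, x + v)` and `(x + v, x)` have the same Gram data and are exchanged by an involution. -/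
lemma hasHalfInvolution_of_dual [CharP K 2] [FiniteDimensional K V] (hQ : Nondefective Q)
    (hT : ∀ v, Q ((T 1 : K[T;T⁻¹]) • v) = Q v) (hind : NoNondegSubmodule Q) {e : ℕ}
    (he : augElt K ^ (e + 1) ∈ Module.annihilator K[T;T⁻¹] V)
    (halt : ∀ x, polar Q (augElt K ^ e • x) x = 0) {x v : V}
    (hvx : polar Q (augElt K ^ e • v) x ≠ 0)
    (hμ : ∀ j : ℕ, polar Q (traceElt K ^ j • v) x = Q (augElt K ^ j • v)) :
    HasHalfInvolution Q := by
  have hzero {a : K[T;T⁻¹]} (ha : augElt K ^ (e + 1) ∣ a) (w : V) : a • w = 0 := by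
    obtain ⟨c, rfl⟩ := ha
    exact Module.mem_annihilator.mp (Ideal.mul_mem_right _ _ he) w
  have htop : Submodule.span K[T;T⁻¹] {x, v} = ⊤ := by
    have hmem (r s : K[T;T⁻¹]) : r • x + s • v ∈ Submodule.span K[T;T⁻¹] {x, v} :=
      Submodule.mem_span_pair.mpr ⟨r, s, rfl⟩
    refine (hind _ fun u hu huW => ?_).resolve_left fun h => ?_
    · obtain ⟨r, s, rfl⟩ := Submodule.mem_span_pair.mp hu
      obtain ⟨hr, hs⟩ := augElt_pow_dvd_of_orthogonal hT he halt hvx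
        (fun t => huW _ (by simpa using hmem t 0)) fun t => huW _ (by simpa using hmem 0 t)
      rw [hzero hr, hzero hs, add_zero]
    · have : x ∈ (⊥ : Submodule K[T;T⁻¹] V) := h ▸ by simpa using hmem 1 0
      rw [Submodule.mem_bot] at this
      simp [this] at hvx
  have htop' : Submodule.span K[T;T⁻¹] {x, x + v} = ⊤ := by
    refine top_le_iff.mp (htop ▸ Submodule.span_le.mpr ?_)
    rintro _ (rfl | rfl)
    · exact Submodule.mem_span_of_mem (by simp)
    · exact Submodule.mem_span_pair.mpr ⟨-1, 1, by simp⟩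
  have hQz : Q (x + v) = Q x := by
    have h := hμ 0
    rw [pow_zero, pow_zero, one_smul, QuadraticMap.polar_comm] at h
    rw [QuadraticMap.map_add Q, h, add_assoc, CharTwo.add_self_eq_zero, add_zero]
  have hTz (n : ℤ) : polar Q ((T n : K[T;T⁻¹]) • (x + v)) (x + v) =
      polar Q ((T n : K[T;T⁻¹]) • x) x := by
    have h := polar_T_smul_self_of_dual hT hμ n
    have h1 : polar Q ((T n : K[T;T⁻¹]) • x) v = polar Q ((T (-n) : K[T;T⁻¹]) • v) x := by
      rw [polar_laurent_smul hT, QuadraticMap.polar_comm, LaurentPolynomial.invert_T]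
    rw [add_smul, QuadraticMap.polar_add_left] at h
    rw [smul_add, QuadraticMap.polar_add_left, QuadraticMap.polar_add_right,
      QuadraticMap.polar_add_right, ← h, h1]
    linear_combination (polar Q ((T (-n) : K[T;T⁻¹]) • v) x +
      polar Q ((T n : K[T;T⁻¹]) • v) x) * CharTwo.two_eq_zero (R := K)
  obtain ⟨σ, hσQ, hσ, hσx⟩ := exists_isometry_semilinear hQ hT ![x, x + v] ![x + v, x]
    (by
      rw [Set.pair_comm] at htop'
      simpa using htop') (by simpa using htop')
    (by simp [Fin.forall_fin_two, hQz]) (by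
      intro a b n
      fin_cases a <;> fin_cases b
      · change polar Q ((T n : K[T;T⁻¹]) • x) x = polar Q (x + v) ((T n : K[T;T⁻¹]) • (x + v))
        rw [QuadraticMap.polar_comm Q (x + v), hTz]
      · simp [QuadraticMap.polar_comm Q (x + v)]
      · simp [QuadraticMap.polar_comm Q x]
      · change polar Q ((T n : K[T;T⁻¹]) • (x + v)) (x + v) = polar Q x ((T n : K[T;T⁻¹]) • x)
        rw [hTz, QuadraticMap.polar_comm])
  have hσ0 : σ x = x + v := hσx 0
  have hσ1 : σ (x + v) = x := hσx 1
  have hinv := involutive_of_semilinear hσ htop' (by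
    rintro _ (rfl | rfl)
    · rw [hσ0, hσ1]
    · rw [hσ1, hσ0])
  refine ⟨σ, hσQ, hinv, hσ, two_mul_finrank_ker_sub_id σ hinv
    ((Submodule.span K[T;T⁻¹] {x}).restrictScalars K) (fun w => ?_) ?_⟩
  · have hw : w ∈ Submodule.span K[T;T⁻¹] {x, x + v} := htop' ▸ Submodule.mem_top
    obtain ⟨r, s, rfl⟩ := Submodule.mem_span_pair.mp hw
    refine ⟨r • x, Submodule.mem_span_singleton.mpr ⟨r, rfl⟩, invert s • x,
      Submodule.mem_span_singleton.mpr ⟨_, rfl⟩, ?_⟩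
    rw [hσ, hσ0, LaurentPolynomial.involutive_invert s]
  · intro a ha b hb hab
    obtain ⟨r, rfl⟩ := Submodule.mem_span_singleton.mp ha
    obtain ⟨s, rfl⟩ := Submodule.mem_span_singleton.mp hb
    rw [hσ, hσ0] at hab
    have h0 : (r - invert s) • x + (-invert s) • v = 0 := by
      rw [sub_smul, hab]; module
    have h1 := augElt_pow_dvd_of_orthogonal hT he halt hvx (r := r - invert s) (s := -invert s)
      (fun t => by rw [h0, QuadraticMap.polar_zero_left])
      (fun t => by rw [h0, QuadraticMap.polar_zero_left])
    refine hzero ?_ x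
    have := dvd_sub h1.1 h1.2
    simpa using this

end Bicyclic

section Indecomposable

variable [Field K] [AddCommGroup V] [Module K V] [FiniteDimensional K V]

lemma exists_polar_eq {Q : QuadraticForm K V} (hQ : Nondefective Q) (μ : Module.Dual K V) :
    ∃ x, ∀ w, polar Q w x = μ w := by
  have hinj : Function.Injective Q.polarBilin := by
    refine (injective_iff_map_eq_zero Q.polarBilin).mpr fun u hu => hQ u fun w => ?_
    exact LinearMap.congr_fun hu w
  obtain ⟨x, hx⟩ := (LinearMap.injective_iff_surjective_of_finrank_eq_finrank
    (Subspace.dual_finrank_eq (K := K) (V := V)).symm).mp hinj μ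
  exact ⟨x, fun w => by rw [QuadraticMap.polar_comm, ← hx, QuadraticMap.polarBilin_apply_apply]⟩

variable [Module K[T;T⁻¹] V] [IsScalarTower K K[T;T⁻¹] V] {Q : QuadraticForm K V}

/-- The bicyclic situation, with exponent `e + 1` of `T + 1`. -/
lemma hasHalfInvolution_of_augElt_pow_smul_ne_zero [CharP K 2] (hQ : Nondefective Q)
    (hT : ∀ v, Q ((T 1 : K[T;T⁻¹]) • v) = Q v) (hind : NoNondegSubmodule Q) {e : ℕ}
    (he : augElt K ^ (e + 1) ∈ Module.annihilator K[T;T⁻¹] V)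
    (halt : ∀ x, polar Q (augElt K ^ e • x) x = 0) {v : V} (hv : augElt K ^ e • v ≠ 0)
    (htrace : ∀ j, e < 2 * j → traceElt K ^ j • v = 0)
    (hmap : ∀ j, e < 2 * j → Q (augElt K ^ j • v) = 0)
    (heven : ∀ j, e = 2 * j → Q (augElt K ^ j • v) ≠ 0) : HasHalfInvolution Q := by
  obtain ⟨μ, hμ⟩ := exists_dual_twisted_orbit he hv
    (fun i => if Even i then Q (augElt K ^ (i / 2) • v) else 1) fun i => -((i / 2 : ℕ) : ℤ)
  obtain ⟨x, hx⟩ := exists_polar_eq hQ μ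
  refine hasHalfInvolution_of_dual hQ hT hind he halt (x := x) (v := v) ?_ fun j => ?_
  · have h := hμ e le_rfl
    rw [T_smul_of_augElt_mul_mem (by rwa [← pow_succ'])] at h
    rw [hx, h]
    split_ifs with h2
    · exact heven _ (Nat.two_mul_div_two_of_even h2).symm
    · exact one_ne_zero
  · rcases le_or_gt (2 * j) e with hj | hj
    · have h := hμ (2 * j) hj
      rw [if_pos (even_two_mul j), Nat.mul_div_cancel_left j two_pos, augElt_pow_two_mul,
        mul_comm (T _), mul_assoc, T_mul_T_neg, mul_one] at h
      rw [hx, h]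
    · rw [htrace j hj, hmap j hj, QuadraticMap.polar_zero_left]

/-- The case where `T` is unipotent and the space is not cyclic. -/
lemma hasHalfInvolution_of_unipotent [CharP K 2] (hQ : Nondefective Q)
    (hT : ∀ v, Q ((T 1 : K[T;T⁻¹]) • v) = Q v) (hind : NoNondegSubmodule Q) {l : ℕ}
    (hl : traceElt K ^ (l + 1) ∈ Module.annihilator K[T;T⁻¹] V)
    (hl' : traceElt K ^ l ∉ Module.annihilator K[T;T⁻¹] V)
    (H : ∀ x, polar Q ((traceElt K ^ l * T 1 : K[T;T⁻¹]) • x) x = 0) : HasHalfInvolution Q := by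
  have htrace (j : ℕ) (hj : l < j) (v : V) : traceElt K ^ j • v = 0 := by
    obtain ⟨k, rfl⟩ := Nat.exists_eq_add_of_le (Nat.succ_le_of_lt hj)
    rw [pow_add]
    exact Module.mem_annihilator.mp (Ideal.mul_mem_right _ _ hl) v
  have hmap (j : ℕ) (hj : l < j) (v : V) : Q (augElt K ^ j • v) = 0 := by
    obtain ⟨k, rfl⟩ := Nat.exists_eq_add_of_lt hj
    rw [map_augElt_pow_succ_smul hT]
    rcases Nat.eq_zero_or_pos k with rfl | hk
    · exact H v
    · rw [mul_comm, mul_smul, htrace _ (by omega), smul_zero, QuadraticMap.polar_zero_left]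
  have htrace_self (x : V) : polar Q (traceElt K ^ l • x) x = 0 := by
    simpa using polar_aeval_traceElt_smul_self hT (X ^ l) x
  obtain ⟨w, hw⟩ : ∃ w : V, traceElt K ^ l • w ≠ 0 := by
    simpa [Module.mem_annihilator] using hl'
  by_cases hN : augElt K * traceElt K ^ l ∈ Module.annihilator K[T;T⁻¹] V
  · have hpow (v : V) : augElt K ^ (2 * l) • v = traceElt K ^ l • v := by
      rw [augElt_pow_two_mul, mul_comm, T_smul_of_augElt_mul_mem hN]
    have hadd (a b : V) : Q (augElt K ^ l • (a + b)) =
        Q (augElt K ^ l • a) + Q (augElt K ^ l • b) + polar Q (traceElt K ^ l • a) b := by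
      rw [smul_add, QuadraticMap.map_add Q, polar_augElt_pow_smul hT]
    obtain ⟨v, hv, hQv⟩ : ∃ v : V, traceElt K ^ l • v ≠ 0 ∧ Q (augElt K ^ l • v) ≠ 0 := by
      by_contra! h
      have hQ0 (y : V) : Q (augElt K ^ l • y) = 0 := by
        by_cases hy : traceElt K ^ l • y = 0
        · have h1 := h (y + w) (by rwa [smul_add, hy, zero_add])
          rwa [hadd, hy, h w hw, QuadraticMap.polar_zero_left, add_zero, add_zero] at h1
        · exact h y hy
      refine hw (hQ _ fun y => ?_)
      have h1 := hadd w y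
      rw [hQ0, hQ0, hQ0, zero_add, zero_add] at h1
      exact h1.symm
    refine hasHalfInvolution_of_augElt_pow_smul_ne_zero hQ hT hind (e := 2 * l) ?_
      (fun x => by rw [hpow, htrace_self]) (v := v) (by rwa [hpow])
      (fun j hj => htrace j (by omega) v) (fun j hj => hmap j (by omega) v) fun j hj => ?_
    · rw [pow_succ', augElt_pow_two_mul, ← mul_assoc]
      exact Ideal.mul_mem_right _ _ hN
    · rwa [← Nat.eq_of_mul_eq_mul_left two_pos hj]
  · have hN' : augElt K * (augElt K * traceElt K ^ l) ∈ Module.annihilator K[T;T⁻¹] V := by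
      have : augElt K * (augElt K * traceElt K ^ l) = traceElt K ^ (l + 1) * T 1 := by
        rw [← mul_assoc, ← pow_two, augElt_sq, pow_succ']; ring
      rw [this]
      exact Ideal.mul_mem_right _ _ hl
    have hpow (v : V) : augElt K ^ (2 * l + 1) • v = (augElt K * traceElt K ^ l) • v := by
      rw [pow_succ', augElt_pow_two_mul, ← mul_assoc, mul_comm, T_smul_of_augElt_mul_mem hN']
    obtain ⟨v, hv⟩ : ∃ v : V, (augElt K * traceElt K ^ l) • v ≠ 0 := by
      simpa only [Module.mem_annihilator, not_forall] using hN
    refine hasHalfInvolution_of_augElt_pow_smul_ne_zero hQ hT hind (e := 2 * l + 1) ?_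
      (fun x => ?_) (v := v) (by rwa [hpow])
      (fun j hj => htrace j (by omega) v) (fun j hj => hmap j (by omega) v) fun j hj => ?_
    · rw [show 2 * l + 1 + 1 = 2 * (l + 1) by ring, augElt_pow_two_mul]
      exact Ideal.mul_mem_right _ _ hl
    · rw [hpow, augElt, add_mul, one_mul, mul_comm, add_smul, QuadraticMap.polar_add_left, H,
        htrace_self, add_zero]
    · omega

omit [FiniteDimensional K V] in
/-- If the form `polar Q ((s * T) • x) x` vanishes for a self-adjoint `s`, then `s * (T + T⁻¹)`
annihilates the space. -/
lemma mul_traceElt_mem_annihilator (hQ : Nondefective Q)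
    (hT : ∀ v, Q ((T 1 : K[T;T⁻¹]) • v) = Q v) {s : K[T;T⁻¹]} (hs : invert s = s)
    (H : ∀ x, polar Q ((s * T 1) • x) x = 0) : s * traceElt K ∈ Module.annihilator K[T;T⁻¹] V := by
  refine Module.mem_annihilator.mpr fun x => hQ _ fun y => ?_
  have h := H (x + y)
  rw [smul_add, QuadraticMap.polar_add_left, QuadraticMap.polar_add_right,
    QuadraticMap.polar_add_right, H, H, zero_add, add_zero, polar_laurent_smul hT _ y,
    QuadraticMap.polar_comm Q y, map_mul, hs, LaurentPolynomial.invert_T] at h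
  change polar Q _ _ = 0
  rw [traceElt, mul_add, add_smul, QuadraticMap.polar_add_left, h]

lemma exists_irreducible_pow_mem_annihilator [Nontrivial V] (hQ : Nondefective Q)
    (hT : ∀ v, Q ((T 1 : K[T;T⁻¹]) • v) = Q v) (hind : NoNondegSubmodule Q) :
    ∃ p : K[X], Irreducible p ∧ (p = X ∨ ∀ v : V, traceElt K • v = 0 → v = 0) ∧
      ∃ n, aeval (traceElt K) p ^ n ∈ Module.annihilator K[T;T⁻¹] V := by
  rcases pow_mem_annihilator_or_injective hQ hT hind (traceElt K)
    (by simpa using invert_aeval_traceElt (X : K[X])) with ⟨n, hn⟩ | hinj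
  · exact ⟨X, irreducible_X, Or.inl rfl, n, by rwa [aeval_X]⟩
  let f : Module.End K V := Algebra.lsmul K K V (traceElt K)
  have hf (v : V) : aeval (traceElt K) (minpoly K f) • v = 0 := by
    have h := LinearMap.congr_fun
      (aeval_algHom_apply (Algebra.lsmul K K V) (traceElt K) (minpoly K f)) v
    rw [minpoly.aeval] at h
    exact h.symm
  by_contra! h
  have hall (q : K[X]) (hq : q ≠ 0) (v : V) (hv : aeval (traceElt K) q • v = 0) : v = 0 := by
    induction q using WfDvdMonoid.induction_on_irreducible generalizing v with
    | zero => exact absurd rfl hq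
    | unit u hu => exact (hu.map (aeval (traceElt K))).smul_eq_zero.mp hv
    | mul a p ha hp ih =>
      rw [map_mul, mul_smul] at hv
      refine ih ha v ((pow_mem_annihilator_or_injective hQ hT hind _
        (invert_aeval_traceElt p)).resolve_left ?_ _ hv)
      exact fun ⟨n, hn⟩ => h p hp (Or.inr hinj) n hn
  obtain ⟨v, hv⟩ := exists_ne (0 : V)
  exact hv (hall _ (minpoly.ne_zero (Algebra.IsIntegral.isIntegral f)) v (hf v))

theorem hasHalfInvolution_of_noNondegSubmodule [CharP K 2] [Nontrivial V] (hQ : Nondefective Q)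
    (hT : ∀ v, Q ((T 1 : K[T;T⁻¹]) • v) = Q v) (hind : NoNondegSubmodule Q) :
    HasHalfInvolution Q := by
  obtain ⟨p, hp, hpX, hn⟩ := exists_irreducible_pow_mem_annihilator hQ hT hind
  classical
  obtain ⟨l, hl⟩ : ∃ l, Nat.find hn = l + 1 := by
    refine Nat.exists_eq_succ_of_ne_zero fun h0 => ?_
    have h := Nat.find_spec hn
    rw [h0, pow_zero] at h
    obtain ⟨v, hv⟩ := exists_ne (0 : V)
    exact hv (by simpa using Module.mem_annihilator.mp h v)
  have hmem : aeval (traceElt K) p ^ (l + 1) ∈ Module.annihilator K[T;T⁻¹] V :=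
    hl ▸ Nat.find_spec hn
  have hnmem : aeval (traceElt K) p ^ l ∉ Module.annihilator K[T;T⁻¹] V :=
    Nat.find_min hn (by omega)
  by_cases hx : ∃ x, polar Q ((aeval (traceElt K) p ^ l * T 1) • x) x ≠ 0
  · obtain ⟨x, hx⟩ := hx
    exact hasHalfInvolution_of_polar_ne_zero hQ hT hind hp hmem (x := x) (q := 1)
      (by rwa [map_one, mul_one])
  · push Not at hx
    have hs : invert (aeval (traceElt K) p ^ l) = aeval (traceElt K) p ^ l := by
      rw [map_pow, invert_aeval_traceElt]
    have h0 := Module.mem_annihilator.mp (mul_traceElt_mem_annihilator hQ hT hs hx)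
    rcases hpX with rfl | hinj
    · rw [aeval_X] at hmem hnmem hx
      exact hasHalfInvolution_of_unipotent hQ hT hind hmem hnmem hx
    · refine absurd (Module.mem_annihilator.mpr fun v => hinj _ ?_) hnmem
      rw [smul_smul, mul_comm, h0]

end Indecomposable

theorem stmt15 [Field K] [AddCommGroup V] [Module K V] [FiniteDimensional K V]
    (Q : QuadraticForm K V) (hQ : Nondefective Q)
    (hchar : ringChar K = 2) (φ : V ≃ₗ[K] V) (hO : InO Q φ)
    (hind : OrthIndec Q φ.toLinearMap) :
    ∃ σ : V ≃ₗ[K] V, InO Q σ ∧ σ * σ = 1 ∧ σ * φ * σ = φ⁻¹ ∧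
      2 * Module.finrank K (LinearMap.ker (σ.toLinearMap - LinearMap.id)) =
        Module.finrank K V := by
  have : CharP K 2 := ringChar.of_eq hchar
  rcases subsingleton_or_nontrivial V with hV | hV
  · refine ⟨1, fun _ => rfl, rfl, Subsingleton.elim _ _, ?_⟩
    rw [finrank_zero_of_subsingleton, finrank_zero_of_subsingleton]
  let ρ : K[T;T⁻¹] →ₐ[K] Module.End K V := AddMonoidAlgebra.lift K (Module.End K V) ℤ
    ((LinearEquiv.automorphismGroup.toLinearMapMonoidHom (R := K) (M := V)).comp
      (zpowersHom (V ≃ₗ[K] V) φ))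
  let : Module K[T;T⁻¹] V := Module.compHom V ρ.toRingHom
  have hsmul (r : K[T;T⁻¹]) (v : V) : r • v = ρ r v := rfl
  have hTn (n : ℤ) (v : V) : (T n : K[T;T⁻¹]) • v = (φ ^ n) v := by
    rw [hsmul, LaurentPolynomial.T, AddMonoidAlgebra.lift_single, one_smul]
    rfl
  have hK (c : K) (v : V) : algebraMap K K[T;T⁻¹] c • v = c • v := by
    rw [hsmul, AlgHom.commutes, Module.algebraMap_end_apply]
  have : IsScalarTower K K[T;T⁻¹] V := IsScalarTower.of_algebraMap_smul hK
  have hT (v : V) : Q ((T 1 : K[T;T⁻¹]) • v) = Q v := by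
    rw [hTn, zpow_one, hO]
  have hnd : NoNondegSubmodule Q := by
    intro W hW
    by_contra! hne
    refine hind ⟨W.restrictScalars K, fun u hu => ?_, ?_, ?_, hW⟩
    · have h := W.smul_mem (T 1) hu
      rwa [hTn, zpow_one] at h
    · rw [Module.finrank_pos_iff, Submodule.nontrivial_iff_ne_bot]
      simpa using hne.1
    · exact Submodule.finrank_lt (by simpa [lt_top_iff_ne_top] using hne.2)
  obtain ⟨σ, hσQ, hσσ, hσ, hker⟩ := hasHalfInvolution_of_noNondegSubmodule hQ hT hnd
  refine ⟨LinearEquiv.ofInvolutive σ hσσ, hσQ, LinearEquiv.ext hσσ, ?_, hker⟩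
  ext v
  have h := hσ (T 1) (σ v)
  rw [hσσ, LaurentPolynomial.invert_T, hTn, hTn, zpow_one, zpow_neg_one] at h
  exact h

end Reversing
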